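/- arXiv:1010.3996 — 2 statements merged into one kernel-verified Lean document; each statement's English description precedes it below -/
import Mathlib

section
/- For every c₀ ≥ 1 there exists a constant C > 0 (depending only on c₀) with the following property. Let τ ∈ ℝ, ξ > 0, q ∈ ℤ, K₁, K₂ ≥ 1, M₁, M₂ ≥ 1, and let I₁, I₂ be intervals. Let B^{2,2} be the set of (ξ₁, q₁) ∈ ℝ×ℤ such that ξ₁ ∈ I₁, ξ − ξ₁ ∈ I₂, M₁ ≤ ξ₁ ≤ 2M₁, M₂ ≤ ξ − ξ₁ ≤ 2M₂, ⟨τ − ξ³ + q²/ξ + 3 ξ ξ₁ (ξ − ξ₁) + (ξ q₁ − ξ₁ q)²/(ξ ξ₁ (ξ − ξ₁))⟩ ≤ c₀ (K₁∨K₂), and max(1, (K₁∨K₂)^{1/2}/(M₁∧M₂)^{1/2}) ≤ |q₁/ξ₁ − (q − q₁)/(ξ − ξ₁)| < (M₁∨M₂)^{1/2} / (M₁∧M₂)^{1/2}. Then μ(B^{2,2}) ≤ C · (K₁∨K₂)^{1/2} (M₁∧M₂)^{1/2}. -/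
open MeasureTheory

/-- Japanese bracket `⟨x⟩ = (1+x²)^{1/2}`. -/
noncomputable def jb (x : ℝ) : ℝ := Real.sqrt (1 + x ^ 2)

lemma abs_le_jb (x : ℝ) : |x| ≤ jb x :=
  Real.abs_le_sqrt (by linarith)

lemma prod_count_le_of_slices {S : Set (ℝ × ℤ)} (hS : MeasurableSet S) {X : Set ℝ}
    {N : ENNReal} (hX : ∀ p ∈ S, p.1 ∈ X)
    (hN : ∀ x, Measure.count (Prod.mk x ⁻¹' S) ≤ N) :
    ((volume : Measure ℝ).prod Measure.count) S ≤ N * volume X := by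
  rw [Measure.prod_apply hS]
  refine le_trans (lintegral_mono fun x => ?_) (lintegral_indicator_const_le X N)
  by_cases hx : x ∈ X
  · simpa [hx] using hN x
  · have : Prod.mk x ⁻¹' S = ∅ := by
      ext k
      simp only [Set.mem_preimage, Set.mem_empty_iff_false, iff_false]
      exact fun h => hx (hX _ h)
    simp [this]

lemma count_int_le_of_abs_sub_le {S : Set ℤ} {L : ℝ} (hL : 0 ≤ L)
    (h : ∀ a ∈ S, ∀ b ∈ S, |(a : ℝ) - b| ≤ L) :
    Measure.count S ≤ ENNReal.ofReal (2 * L + 1) := by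
  rcases S.eq_empty_or_nonempty with rfl | ⟨a, ha⟩
  · simp
  have hsub : S ⊆ (Finset.Icc (a - ⌊L⌋) (a + ⌊L⌋) : Finset ℤ) := by
    intro b hb
    have h1 := abs_le.mp (h b hb a ha)
    have h2 : b - a ≤ ⌊L⌋ := Int.le_floor.mpr (by push_cast; linarith)
    have h3 : a - b ≤ ⌊L⌋ := Int.le_floor.mpr (by push_cast; linarith)
    simp only [Finset.coe_Icc, Set.mem_Icc]
    omega
  refine (measure_mono hsub).trans ?_
  rw [Measure.count_apply_finset, Int.card_Icc, ← ENNReal.ofReal_natCast]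
  apply ENNReal.ofReal_le_ofReal
  have h0 : 0 ≤ ⌊L⌋ := Int.floor_nonneg.mpr hL
  have h1 : (((a + ⌊L⌋ + 1 - (a - ⌊L⌋)).toNat : ℤ) : ℝ) = 2 * ⌊L⌋ + 1 := by
    rw [Int.toNat_of_nonneg (by omega)]
    push_cast
    ring
  rw [Int.cast_natCast] at h1
  rw [h1]
  linarith [Int.floor_le L]

lemma volume_le_of_abs_sub_le {S : Set ℝ} {L : ℝ}
    (h : ∀ a ∈ S, ∀ b ∈ S, |a - b| ≤ L) : volume S ≤ ENNReal.ofReal L := by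
  refine (Real.volume_le_diam S).trans (Metric.ediam_le fun a ha b hb => ?_)
  rw [edist_dist, Real.dist_eq]
  exact ENNReal.ofReal_le_ofReal (h a ha b hb)

lemma volume_abs_mul_sub_sub_le (ξ s R : ℝ) :
    volume {x : ℝ | |x * (ξ - x) - s| ≤ R} ≤ ENNReal.ofReal (2 * √(2 * R)) := by
  have hsub : {x : ℝ | |x * (ξ - x) - s| ≤ R} ⊆
      {x : ℝ | |x * (ξ - x) - s| ≤ R ∧ ξ ≤ 2 * x} ∪
        {x : ℝ | |x * (ξ - x) - s| ≤ R ∧ 2 * x ≤ ξ} := by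
    intro x hx
    rcases le_total ξ (2 * x) with h | h
    · exact Or.inl ⟨hx, h⟩
    · exact Or.inr ⟨hx, h⟩
  refine (measure_mono hsub).trans ((measure_union_le _ _).trans ?_)
  rw [two_mul (√(2 * R)), ENNReal.ofReal_add (by positivity) (by positivity)]
  gcongr <;> refine volume_le_of_abs_sub_le ?_
  · rintro a ⟨ha, ha'⟩ b ⟨hb, hb'⟩
    rw [abs_le] at ha hb
    apply Real.abs_le_sqrt
    rcases le_total a b with h | h <;> nlinarith
  · rintro a ⟨ha, ha'⟩ b ⟨hb, hb'⟩
    rw [abs_le] at ha hb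
    apply Real.abs_le_sqrt
    rcases le_total a b with h | h <;> nlinarith

lemma mul_sub_le_of_abs_add_sq_mul_le {A h D D' P d : ℝ} (hh : 0 ≤ h)
    (hD : d ≤ D) (hD' : d ≤ D')
    (h1 : |A + D ^ 2 * h| ≤ P) (h2 : |A + D' ^ 2 * h| ≤ P) :
    h * |D - D'| * d ≤ P := by
  rw [abs_le] at h1 h2
  rcases le_total D D' with hDD | hDD
  · rw [abs_of_nonpos (by linarith)]
    have : 0 ≤ h * (D' - D) := mul_nonneg hh (by linarith)
    nlinarith [mul_le_mul_of_nonneg_left (add_le_add hD hD') this]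
  · rw [abs_of_nonneg (by linarith)]
    have : 0 ≤ h * (D - D') := mul_nonneg hh (by linarith)
    nlinarith [mul_le_mul_of_nonneg_left (add_le_add hD hD') this]

/-- Integers `k` whose slope `k / x - (q - k) / y` is bounded away from zero and for which the
quadratic phase lies in a bounded window. -/
lemma count_slice_le {x y A q P d : ℝ} (hx : 0 < x) (hy : 0 < y) (hP : 0 ≤ P) (hd : 0 < d) :
    Measure.count {k : ℤ | |A + ((k : ℝ) / x - (q - k) / y) ^ 2 * (x * y / (x + y))| ≤ P ∧
      d ≤ |(k : ℝ) / x - (q - k) / y|} ≤ ENNReal.ofReal (2 * (2 * (P / d) + 1)) := by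
  set D : ℤ → ℝ := fun k => (k : ℝ) / x - (q - k) / y with hDdef
  set h := x * y / (x + y) with hh
  have hh0 : 0 < h := by positivity
  have hstep : ∀ a b : ℤ, h * |D a - D b| = |(a : ℝ) - b| := by
    intro a b
    have : (a : ℝ) - b = h * (D a - D b) := by
      simp only [hDdef, hh]
      field_simp
      ring
    rw [this, abs_mul, abs_of_pos hh0]
  have hsub : {k : ℤ | |A + D k ^ 2 * h| ≤ P ∧ d ≤ |D k|} ⊆
      {k : ℤ | |A + D k ^ 2 * h| ≤ P ∧ d ≤ D k} ∪
        {k : ℤ | |A + D k ^ 2 * h| ≤ P ∧ d ≤ -D k} := by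
    rintro k ⟨hk, hk'⟩
    rcases le_abs.mp hk' with h | h
    · exact Or.inl ⟨hk, h⟩
    · exact Or.inr ⟨hk, h⟩
  refine (measure_mono hsub).trans ((measure_union_le _ _).trans ?_)
  rw [two_mul (2 * (P / d) + 1), ENNReal.ofReal_add (by positivity) (by positivity)]
  gcongr <;> refine count_int_le_of_abs_sub_le (by positivity) ?_
  · rintro a ⟨ha, ha'⟩ b ⟨hb, hb'⟩
    rw [le_div_iff₀ hd, ← hstep]
    exact mul_sub_le_of_abs_add_sq_mul_le hh0.le ha' hb' ha hb
  · rintro a ⟨ha, ha'⟩ b ⟨hb, hb'⟩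
    rw [le_div_iff₀ hd, ← hstep, abs_sub_comm, ← neg_sub_neg]
    rw [← neg_sq] at ha hb
    exact mul_sub_le_of_abs_add_sq_mul_le hh0.le ha' hb' ha hb

lemma resonance_quadratic_eq {x y q k : ℝ} (hx : 0 < x) (hy : 0 < y) :
    ((x + y) * k - x * q) ^ 2 / ((x + y) * x * y) =
      (k / x - (q - k) / y) ^ 2 * (x * y / (x + y)) := by
  have : 0 < x + y := by positivity
  field_simp
  ring

lemma mul_div_add_le {x y m : ℝ} (hx : 0 < x) (hy : 0 < y) (h : x ≤ 2 * m ∨ y ≤ 2 * m) :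
    x * y / (x + y) ≤ 2 * m := by
  rw [div_le_iff₀ (by positivity)]
  rcases h with h | h <;> nlinarith

set_option maxHeartbeats 800000 in
/-- size estimate for the region `B^{2,2}` (second part of Lemma 2.5). -/
theorem measure_B22_le (c₀ : ℝ) (hc₀ : 1 ≤ c₀) :
    ∃ C : ℝ, 0 < C ∧
      ∀ (τ ξ : ℝ) (q : ℤ) (K₁ K₂ M₁ M₂ : ℝ) (I₁ I₂ : Set ℝ),
        0 < ξ → 1 ≤ K₁ → 1 ≤ K₂ → 1 ≤ M₁ → 1 ≤ M₂ →
        I₁.OrdConnected → I₂.OrdConnected →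
        ((volume : Measure ℝ).prod Measure.count)
            {p : ℝ × ℤ | p.1 ∈ I₁ ∧ ξ - p.1 ∈ I₂ ∧
              M₁ ≤ p.1 ∧ p.1 ≤ 2 * M₁ ∧ M₂ ≤ ξ - p.1 ∧ ξ - p.1 ≤ 2 * M₂ ∧
              jb (τ - ξ ^ 3 + (q : ℝ) ^ 2 / ξ + 3 * ξ * p.1 * (ξ - p.1) +
                  (ξ * (p.2 : ℝ) - p.1 * (q : ℝ)) ^ 2 /
                    (ξ * p.1 * (ξ - p.1))) ≤ c₀ * max K₁ K₂ ∧
              max 1 ((max K₁ K₂) ^ ((1 : ℝ) / 2) / (min M₁ M₂) ^ ((1 : ℝ) / 2)) ≤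
                |(p.2 : ℝ) / p.1 - ((q : ℝ) - (p.2 : ℝ)) / (ξ - p.1)| ∧
              |(p.2 : ℝ) / p.1 - ((q : ℝ) - (p.2 : ℝ)) / (ξ - p.1)| <
                (max M₁ M₂) ^ ((1 : ℝ) / 2) / (min M₁ M₂) ^ ((1 : ℝ) / 2)} ≤
          ENNReal.ofReal
            (C * (max K₁ K₂) ^ ((1 : ℝ) / 2) * (min M₁ M₂) ^ ((1 : ℝ) / 2)) := by
  refine ⟨12 * c₀ * √(2 * c₀), by positivity, ?_⟩
  intro τ ξ q K₁ K₂ M₁ M₂ I₁ I₂ hξ hK₁ _ hM₁ hM₂ _ _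
  simp only [← Real.sqrt_eq_rpow]
  set K := max K₁ K₂
  set m := min M₁ M₂ with hm
  set M := max M₁ M₂
  have hK : 1 ≤ K := le_max_of_le_left hK₁
  have hm1 : 1 ≤ m := le_min hM₁ hM₂
  have hmM : m ≤ M := min_le_max
  have ha : 1 ≤ √K := Real.one_le_sqrt.mpr hK
  have hb : 1 ≤ √m := Real.one_le_sqrt.mpr hm1
  have ha2 : √K ^ 2 = K := Real.sq_sqrt (by linarith)
  have hb2 : √m ^ 2 = m := Real.sq_sqrt (by linarith)
  have hM2 : √M ^ 2 = M := Real.sq_sqrt (by linarith)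
  set T := τ - ξ ^ 3 + (q : ℝ) ^ 2 / ξ
  set S : Set (ℝ × ℤ) := {p | (M₁ ≤ p.1 ∧ p.1 ≤ 2 * M₁ ∧ M₂ ≤ ξ - p.1 ∧ ξ - p.1 ≤ 2 * M₂) ∧
      |T + 3 * ξ * p.1 * (ξ - p.1) + ((p.2 : ℝ) / p.1 - ((q : ℝ) - p.2) / (ξ - p.1)) ^ 2 *
        (p.1 * (ξ - p.1) / ξ)| ≤ c₀ * K ∧
      √K / √m ≤ |(p.2 : ℝ) / p.1 - ((q : ℝ) - p.2) / (ξ - p.1)| ∧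
      |(p.2 : ℝ) / p.1 - ((q : ℝ) - p.2) / (ξ - p.1)| < √M / √m}
  have hSm : MeasurableSet S := by
    have hc : Measurable fun p : ℝ × ℤ => (p.2 : ℝ) := measurable_from_top.comp measurable_snd
    have hD : Measurable fun p : ℝ × ℤ =>
        (p.2 : ℝ) / p.1 - ((q : ℝ) - p.2) / (ξ - p.1) := by fun_prop
    have h1 : Measurable fun p : ℝ × ℤ => p.1 := measurable_fst
    have h2 : Measurable fun p : ℝ × ℤ => ξ - p.1 := by fun_prop
    have hle : ∀ {f g : ℝ × ℤ → ℝ}, Measurable f → Measurable g →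
        Measurable fun p => f p ≤ g p :=
      fun hf hg => measurableSet_setOfPred.mp (measurableSet_le hf hg)
    have hlt : ∀ {f g : ℝ × ℤ → ℝ}, Measurable f → Measurable g →
        Measurable fun p => f p < g p :=
      fun hf hg => measurableSet_setOfPred.mp (measurableSet_lt hf hg)
    refine measurableSet_setOfPred.mpr (.and (.and (hle ?_ h1) (.and (hle h1 ?_)
      (.and (hle ?_ h2) (hle h2 ?_)))) (.and (hle ?_ ?_) (.and (hle ?_ ?_) (hlt ?_ ?_)))) <;>
      fun_prop
  refine (measure_mono (t := S) ?_).trans ?_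
  · rintro ⟨x, k⟩ ⟨-, -, h1, h2, h3, h4, h5, h6, h7⟩
    dsimp only at *
    refine ⟨⟨h1, h2, h3, h4⟩, ?_, (le_max_right _ _).trans h6, h7⟩
    refine le_trans ?_ ((abs_le_jb _).trans h5)
    have h := resonance_quadratic_eq (x := x) (y := ξ - x) (q := q) (k := k)
      (by linarith) (by linarith)
    rw [add_sub_cancel] at h
    rw [h]
  have hfst : ∀ p ∈ S, p.1 ∈ {x : ℝ | |x * (ξ - x) - -(T / (3 * ξ))| ≤ c₀} := by
    rintro ⟨x, k⟩ ⟨⟨h1, h2, h3, h4⟩, h5, h6, h7⟩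
    dsimp only at *
    set D := (k : ℝ) / x - ((q : ℝ) - k) / (ξ - x)
    have hx : 0 < x := by linarith
    have hy : 0 < ξ - x := by linarith
    have hKM : K ≤ M := by
      have h8 := h6.trans_lt h7
      rw [div_lt_div_iff_of_pos_right (by linarith)] at h8
      nlinarith
    have hD : D ^ 2 * m ≤ M := by
      rw [lt_div_iff₀ (by linarith)] at h7
      rw [← hb2, ← hM2, ← sq_abs, ← mul_pow]
      exact pow_le_pow_left₀ (by positivity) h7.le 2
    have hMξ : M ≤ ξ := max_le (by linarith) (by linarith)
    have hh : x * (ξ - x) / ξ ≤ 2 * m := by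
      have h := mul_div_add_le (m := m) hx hy (by
        rcases min_choice M₁ M₂ with h | h
        · exact Or.inl (by rw [hm, h]; exact h2)
        · exact Or.inr (by rw [hm, h]; exact h4))
      rwa [add_sub_cancel] at h
    have hh0 : 0 ≤ x * (ξ - x) / ξ := by positivity
    have hDh : D ^ 2 * (x * (ξ - x) / ξ) ≤ 2 * M := by
      nlinarith [mul_le_mul_of_nonneg_left hh (sq_nonneg D)]
    have hDh0 : 0 ≤ D ^ 2 * (x * (ξ - x) / ξ) := by positivity
    have hcK : c₀ * K ≤ c₀ * ξ := by gcongr; linarith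
    have hcξ : ξ ≤ c₀ * ξ := by nlinarith
    have hprod : 3 * ξ * (x * (ξ - x) - -(T / (3 * ξ))) = T + 3 * ξ * x * (ξ - x) := by
      field_simp
      ring
    rw [Set.mem_ofPred_eq]
    refine le_of_mul_le_mul_left ?_ (show 0 < 3 * ξ by positivity)
    rw [← abs_of_pos (show 0 < 3 * ξ by positivity), ← abs_mul,
      abs_of_pos (show 0 < 3 * ξ by positivity), hprod]
    rw [abs_le] at h5 ⊢
    constructor <;> nlinarith
  have hslice : ∀ x, Measure.count (Prod.mk x ⁻¹' S) ≤ ENNReal.ofReal (6 * c₀ * √K * √m) := by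
    intro x
    by_cases hx : M₁ ≤ x ∧ M₂ ≤ ξ - x
    · have h := count_slice_le (x := x) (y := ξ - x) (A := T + 3 * ξ * x * (ξ - x)) (q := q)
        (P := c₀ * K) (d := √K / √m) (by linarith) (by linarith) (by positivity) (by positivity)
      rw [add_sub_cancel] at h
      refine (measure_mono ?_).trans (h.trans (ENNReal.ofReal_le_ofReal ?_))
      · rintro k ⟨-, h5, h6, -⟩
        exact ⟨h5, h6⟩
      · have hdiv : c₀ * K / (√K / √m) = c₀ * (√K * √m) := by
          nth_rewrite 1 [← ha2]
          field_simp
        have h1 : 1 ≤ √K * √m := one_le_mul_of_one_le_of_one_le ha hb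
        have h2 : 1 ≤ c₀ * (√K * √m) := one_le_mul_of_one_le_of_one_le hc₀ h1
        rw [hdiv]
        linarith
    · have : Prod.mk x ⁻¹' S = ∅ := by
        ext k
        simp only [Set.mem_preimage, Set.mem_empty_iff_false, iff_false]
        exact fun h => hx ⟨h.1.1, h.1.2.2.1⟩
      simp [this]
  refine (prod_count_le_of_slices hSm hfst hslice).trans ?_
  refine (mul_le_mul_right (volume_abs_mul_sub_sub_le _ _ _) _).trans ?_
  rw [← ENNReal.ofReal_mul (by positivity)]
  apply ENNReal.ofReal_le_ofReal
  apply le_of_eq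
  ring
end

section
/- For every ε > 0 there exists a constant C_ε > 0 such that for all real numbers a and b, ∫_ℝ ⟨θ − a⟩^{−(1+2ε)} |θ − b|^{−1/2} dθ ≤ C_ε · ⟨a − b⟩^{−1/2}. -/
open MeasureTheory

theorem one_le_jb (x : ℝ) : 1 ≤ jb x :=
  Real.one_le_sqrt.mpr (by nlinarith [sq_nonneg x])

theorem jb_add_le (x y : ℝ) : jb (x + y) ≤ jb x + |y| := by
  have hx : 0 ≤ jb x := Real.sqrt_nonneg _
  have hsq : jb x ^ 2 = 1 + x ^ 2 := Real.sq_sqrt (by positivity)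
  have habs : |x| ≤ jb x := Real.abs_le_sqrt (by linarith)
  refine Real.sqrt_le_iff.mpr ⟨by positivity, ?_⟩
  have hxy : x * y ≤ jb x * |y| :=
    (le_abs_self _).trans (by rw [abs_mul]; gcongr)
  nlinarith [sq_abs y]

theorem jb_rpow_eq (x r : ℝ) : jb x ^ (-r) = (1 + ‖x‖ ^ 2) ^ (-r / 2) := by
  rw [jb, Real.sqrt_eq_rpow, ← Real.rpow_mul (by positivity), Real.norm_eq_abs, sq_abs]
  congr 1
  ring

theorem integrable_jb_rpow_neg {r : ℝ} (hr : 1 < r) :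
    Integrable (fun x : ℝ => jb x ^ (-r)) := by
  simp only [jb_rpow_eq]
  exact integrable_rpow_neg_one_add_norm_sq (by simpa using hr)

theorem integrable_indicator_abs_rpow (c : ℝ) :
    Integrable (fun x : ℝ => (Set.Iio c).indicator (fun t => t ^ (-(1 : ℝ) / 2)) |x|) := by
  have hloc : LocallyIntegrable (fun x : ℝ => |x| ^ (-(1 : ℝ) / 2)) := by
    refine locallyIntegrable_of_norm_le_rpow (C := 1) (α := 1 / 2) (by simp) (by norm_num) ?_ ?_
    · refine ae_of_all _ fun x => ?_
      rw [Real.norm_of_nonneg (by positivity), Real.norm_eq_abs, one_mul, neg_div]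
    · exact Measurable.aestronglyMeasurable (by fun_prop)
  have hon : IntegrableOn (fun x : ℝ => |x| ^ (-(1 : ℝ) / 2)) (Set.Ioo (-c) c) :=
    (hloc.integrableOn_isCompact isCompact_Icc).mono_set Set.Ioo_subset_Icc_self
  refine (hon.integrable_indicator measurableSet_Ioo).congr (ae_of_all _ fun x => ?_)
  simp only [Set.indicator_apply, Set.mem_Ioo, Set.mem_Iio, abs_lt]

theorem integral_indicator_abs_rpow {c : ℝ} (hc : 0 ≤ c) :
    ∫ x : ℝ, (Set.Iio c).indicator (fun t => t ^ (-(1 : ℝ) / 2)) |x| =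
      4 * c ^ ((1 : ℝ) / 2) := by
  rw [integral_comp_abs, setIntegral_indicator measurableSet_Iio, Set.Ioi_inter_Iio,
    ← integral_Ioc_eq_integral_Ioo, ← intervalIntegral.integral_of_le hc,
    integral_rpow (Or.inl (by norm_num))]
  norm_num
  ring

theorem jb_rpow_mul_abs_rpow_le {r : ℝ} (hr : 1 ≤ r) (a b θ : ℝ) :
    jb (θ - a) ^ (-r) * |θ - b| ^ (-(1 : ℝ) / 2) ≤
      2 * jb (a - b) ^ (-(1 : ℝ) / 2) * jb (θ - a) ^ (-r) +
        2 * (jb (a - b))⁻¹ *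
          (Set.Iio (jb (a - b) / 2)).indicator (fun t => t ^ (-(1 : ℝ) / 2)) |θ - b| := by
  have hw := one_le_jb (θ - a)
  have hR := one_le_jb (a - b)
  have htri : jb (a - b) ≤ jb (θ - a) + |θ - b| := by
    have h := jb_add_le (-(θ - a)) (θ - b)
    rwa [show -(θ - a) + (θ - b) = a - b by ring,
      show jb (-(θ - a)) = jb (θ - a) by simp only [jb, neg_sq]] at h
  set w := jb (θ - a)
  set R := jb (a - b)
  have hw0 : 0 < w := by linarith
  have hR0 : 0 < R := by linarith
  by_cases hs : |θ - b| < R / 2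
  · rw [Set.indicator_of_mem (Set.mem_Iio.mpr hs)]
    have hweight : w ^ (-r) ≤ 2 * R⁻¹ := calc
      w ^ (-r) ≤ w ^ (-1 : ℝ) := Real.rpow_le_rpow_of_exponent_le hw (by linarith)
      _ = w⁻¹ := Real.rpow_neg_one w
      _ ≤ (R / 2)⁻¹ := inv_anti₀ (by positivity) (by linarith)
      _ = 2 * R⁻¹ := by rw [inv_div, div_eq_mul_inv]
    calc w ^ (-r) * |θ - b| ^ (-(1 : ℝ) / 2)
        ≤ 2 * R⁻¹ * |θ - b| ^ (-(1 : ℝ) / 2) := by gcongr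
      _ ≤ _ := le_add_of_nonneg_left (by positivity)
  · rw [Set.indicator_of_notMem (by simpa using hs), mul_zero, add_zero, mul_comm]
    have htwo : (2 : ℝ) ^ ((1 : ℝ) / 2) ≤ 2 := by
      simpa using Real.rpow_le_rpow_of_exponent_le (x := 2) (y := 1 / 2) (z := 1)
        (by norm_num) (by norm_num)
    have hroot : |θ - b| ^ (-(1 : ℝ) / 2) ≤ 2 * R ^ (-(1 : ℝ) / 2) := calc
      |θ - b| ^ (-(1 : ℝ) / 2) ≤ (R / 2) ^ (-(1 : ℝ) / 2) :=
        Real.rpow_le_rpow_of_nonpos (by positivity) (not_lt.mp hs) (by norm_num)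
      _ = 2 ^ ((1 : ℝ) / 2) * R ^ (-(1 : ℝ) / 2) := by
        rw [Real.div_rpow hR0.le (by norm_num), neg_div, Real.rpow_neg (x := 2) (by norm_num),
          div_inv_eq_mul, mul_comm]
      _ ≤ 2 * R ^ (-(1 : ℝ) / 2) := by gcongr
    gcongr

/-- the elementary inequality
`∫ ⟨θ−a⟩^{−(1+2ε)} |θ−b|^{−1/2} dθ ≲ ⟨a−b⟩^{−1/2}`. -/
theorem integral_jb_mul_rpow_le (ε : ℝ) (hε : 0 < ε) :
    ∃ C : ℝ, 0 < C ∧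
      ∀ a b : ℝ,
        (∫ θ : ℝ, jb (θ - a) ^ (-(1 + 2 * ε)) * |θ - b| ^ (-(1 : ℝ) / 2)) ≤
          C * jb (a - b) ^ (-(1 : ℝ) / 2) := by
  have hjb (x : ℝ) : 0 ≤ jb x := Real.sqrt_nonneg _
  have hK : 0 ≤ ∫ θ : ℝ, jb θ ^ (-(1 + 2 * ε)) :=
    integral_nonneg fun θ => Real.rpow_nonneg (hjb θ) _
  refine ⟨2 * (∫ θ : ℝ, jb θ ^ (-(1 + 2 * ε))) + 8, by positivity, fun a b => ?_⟩
  have hR := one_le_jb (a - b)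
  have hdecay : Integrable (fun θ : ℝ => jb (θ - a) ^ (-(1 + 2 * ε))) :=
    (integrable_jb_rpow_neg (by linarith)).comp_sub_right a
  have hsing := (integrable_indicator_abs_rpow (jb (a - b) / 2)).comp_sub_right b
  refine (integral_mono_of_nonneg
    (ae_of_all _ fun θ => mul_nonneg (Real.rpow_nonneg (hjb _) _) (by positivity))
    ((hdecay.const_mul (2 * jb (a - b) ^ (-(1 : ℝ) / 2))).add
      (hsing.const_mul (2 * (jb (a - b))⁻¹)))
    (ae_of_all _ fun θ => jb_rpow_mul_abs_rpow_le (by linarith) a b θ)).trans ?_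
  simp only [Pi.add_apply]
  rw [integral_add (hdecay.const_mul _) (hsing.const_mul _), integral_const_mul,
    integral_const_mul, integral_sub_right_eq_self (fun θ => jb θ ^ (-(1 + 2 * ε))) a,
    integral_sub_right_eq_self
      (fun x : ℝ => (Set.Iio (jb (a - b) / 2)).indicator (fun t => t ^ (-(1 : ℝ) / 2)) |x|) b,
    integral_indicator_abs_rpow (by linarith)]
  have hroot : (jb (a - b))⁻¹ * (jb (a - b) / 2) ^ ((1 : ℝ) / 2) ≤
      jb (a - b) ^ (-(1 : ℝ) / 2) := calc
    _ ≤ (jb (a - b))⁻¹ * jb (a - b) ^ ((1 : ℝ) / 2) := by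
      gcongr
      linarith
    _ = jb (a - b) ^ (-(1 : ℝ) / 2) := by
      rw [← Real.rpow_neg_one, ← Real.rpow_add (by linarith)]
      norm_num
  linarith
end
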